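/- Let Δ ⊆ ℝⁿ be a nonempty compact convex set, μ ∈ ℝⁿ, and Σ ∈ ℝⁿˣⁿ symmetric positive definite. Define α(φ) = min_{θ ∈ Δ} ( −μᵀθ + (φ/2)·θᵀΣθ ) for φ > 0, and let θ̂(φ) ∈ Δ be the unique minimizer. Then α is differentiable on (0,∞) with α'(φ) = (1/2)·θ̂(φ)ᵀ Σ θ̂(φ), and the derivative α' is locally Lipschitz continuous on (0,∞); i.e. α is C^{1,1} on compact subintervals of (0,∞). -/

import Mathlib

open Set Matrix NNReal

lemma mk_symm {n : ℕ} (S : Matrix (Fin n) (Fin n) ℝ) (hS : S.PosDef) (x y : Fin n → ℝ) :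
    y ⬝ᵥ S.mulVec x = x ⬝ᵥ S.mulVec y := by
  have h : Sᵀ = S := by
    have := hS.isHermitian
    rwa [Matrix.IsHermitian, Matrix.conjTranspose_eq_transpose_of_trivial] at this
  rw [dotProduct_mulVec, ← mulVec_transpose, h, dotProduct_comm]

lemma mk_nonneg {n : ℕ} (S : Matrix (Fin n) (Fin n) ℝ) (hS : S.PosDef) (x : Fin n → ℝ) :
    0 ≤ x ⬝ᵥ S.mulVec x := by
  simpa using hS.posSemidef.dotProduct_mulVec_nonneg x

lemma mk_lin {n : ℕ} (S : Matrix (Fin n) (Fin n) ℝ) (hS : S.PosDef) (x y : Fin n → ℝ) (s t : ℝ) :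
    (s • x + t • y) ⬝ᵥ S.mulVec (s • x + t • y) =
      s ^ 2 * (x ⬝ᵥ S.mulVec x) + 2 * (s * t) * (x ⬝ᵥ S.mulVec y) + t ^ 2 * (y ⬝ᵥ S.mulVec y) := by
  simp only [mulVec_add, mulVec_smul, dotProduct_add, add_dotProduct, smul_dotProduct,
    dotProduct_smul, smul_eq_mul, mk_symm S hS x y]
  ring

lemma mk_cs {n : ℕ} (S : Matrix (Fin n) (Fin n) ℝ) (hS : S.PosDef) (x y : Fin n → ℝ) :
    (y ⬝ᵥ S.mulVec y - x ⬝ᵥ S.mulVec x) ^ 2 ≤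
      (x ⬝ᵥ S.mulVec x - 2 * (x ⬝ᵥ S.mulVec y) + y ⬝ᵥ S.mulVec y) *
      (2 * (x ⬝ᵥ S.mulVec x) + 2 * (y ⬝ᵥ S.mulVec y)) := by
  have hd : ∀ t : ℝ, 0 ≤ (x ⬝ᵥ S.mulVec x) * (t * t) + (2 * (x ⬝ᵥ S.mulVec y)) * t
      + (y ⬝ᵥ S.mulVec y) := by
    intro t
    have h := mk_nonneg S hS (t • x + (1 : ℝ) • y)
    rw [mk_lin S hS] at h
    linarith
  have h := discrim_le_zero hd
  have h1 := mk_nonneg S hS ((1 : ℝ) • x + (-1 : ℝ) • y)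
  rw [mk_lin S hS] at h1
  rw [discrim] at h
  nlinarith [sq_nonneg (x ⬝ᵥ S.mulVec x - 2 * (x ⬝ᵥ S.mulVec y) + y ⬝ᵥ S.mulVec y)]

/-- In the Markowitz setting (`Δ` nonempty compact convex, `S` symmetric
positive definite), with `α(φ) = min_{θ ∈ Δ}(−μᵀθ + (φ/2)·θᵀSθ)` and `θhat φ` the
unique minimizer for `φ > 0`, the value function `α` is differentiable on `(0,∞)` with
`α'(φ) = (1/2)·θhat(φ)ᵀ S θhat(φ)`, and this derivative is Lipschitz continuous on
every compact subinterval `[a,b] ⊆ (0,∞)`; i.e. `α` is `C^{1,1}` there. -/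
theorem markowitz_value_function_C11
    {n : ℕ} (Δ : Set (Fin n → ℝ)) (hΔc : IsCompact Δ) (hΔconv : Convex ℝ Δ)
    (hΔne : Δ.Nonempty)
    (μ : Fin n → ℝ) (S : Matrix (Fin n) (Fin n) ℝ) (hS : S.PosDef)
    (α : ℝ → ℝ)
    (hα : ∀ φ : ℝ, α φ =
      sInf ((fun θ => -(μ ⬝ᵥ θ) + φ / 2 * (θ ⬝ᵥ S.mulVec θ)) '' Δ))
    (θhat : ℝ → (Fin n → ℝ))
    (hθhat : ∀ φ : ℝ, 0 < φ → θhat φ ∈ Δ ∧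
      ∀ θ ∈ Δ, -(μ ⬝ᵥ θhat φ) + φ / 2 * (θhat φ ⬝ᵥ S.mulVec (θhat φ))
        ≤ -(μ ⬝ᵥ θ) + φ / 2 * (θ ⬝ᵥ S.mulVec θ)) :
    (∀ φ : ℝ, 0 < φ →
      HasDerivAt α (1 / 2 * (θhat φ ⬝ᵥ S.mulVec (θhat φ))) φ) ∧
    (∀ a b : ℝ, 0 < a → ∃ K : ℝ≥0,
      LipschitzOnWith K (fun φ => 1 / 2 * (θhat φ ⬝ᵥ S.mulVec (θhat φ))) (Icc a b)) := by
  set q : (Fin n → ℝ) → ℝ := fun θ => θ ⬝ᵥ S.mulVec θ with hq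
  obtain ⟨M, hM0, hM⟩ : ∃ M : ℝ, 0 < M ∧ ∀ θ ∈ Δ, q θ ≤ M := by
    have hc : Continuous q := by
      simp only [hq]
      fun_prop
    obtain ⟨M, hM⟩ := (hΔc.image hc).bddAbove
    exact ⟨max M 1, by positivity, fun θ h => (hM ⟨θ, h, rfl⟩).trans (le_max_left _ _)⟩
  have hmin : ∀ φ, 0 < φ → α φ = -(μ ⬝ᵥ θhat φ) + φ / 2 * q (θhat φ) := by
    intro φ hφ
    rw [hα]
    apply IsLeast.csInf_eq
    refine ⟨⟨θhat φ, (hθhat φ hφ).1, rfl⟩, ?_⟩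
    rintro _ ⟨θ, hθ, rfl⟩
    exact (hθhat φ hφ).2 θ hθ
  have hstrong : ∀ φ, 0 < φ → ∀ y ∈ Δ,
      φ / 4 * (q (θhat φ) - 2 * (θhat φ ⬝ᵥ S.mulVec y) + q y) ≤
        (-(μ ⬝ᵥ y) + φ / 2 * q y) - (-(μ ⬝ᵥ θhat φ) + φ / 2 * q (θhat φ)) := by
    intro φ hφ y hy
    have hm := hΔconv (hθhat φ hφ).1 hy (by norm_num : (0:ℝ) ≤ 1/2) (by norm_num : (0:ℝ) ≤ 1/2)
      (by norm_num)
    have h := (hθhat φ hφ).2 _ hm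
    rw [mk_lin S hS] at h
    simp only [dotProduct_add, dotProduct_smul, smul_eq_mul] at h
    simp only [hq]
    linarith
  have key : ∀ a, 0 < a → ∀ φ ψ, a ≤ φ → a ≤ ψ →
      |1 / 2 * q (θhat ψ) - 1 / 2 * q (θhat φ)| ≤ 2 * M / a * |ψ - φ| := by
    intro a ha φ ψ hφ hψ
    have hφ0 := ha.trans_le hφ
    have hψ0 := ha.trans_le hψ
    have h1 := hstrong φ hφ0 _ (hθhat ψ hψ0).1
    have h2 := hstrong ψ hψ0 _ (hθhat φ hφ0).1
    rw [mk_symm S hS (θhat φ) (θhat ψ)] at h2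
    have h3 : (q (θhat ψ) - q (θhat φ)) ^ 2 ≤ _ := mk_cs S hS (θhat φ) (θhat ψ)
    have h4 := mk_nonneg S hS ((1 : ℝ) • θhat φ + (-1 : ℝ) • θhat ψ)
    rw [mk_lin S hS] at h4
    have m1 := hM _ (hθhat φ hφ0).1
    have m2 := hM _ (hθhat ψ hψ0).1
    change _ ≤ (q (θhat φ) - 2 * (θhat φ ⬝ᵥ S.mulVec (θhat ψ)) + q (θhat ψ)) *
      (2 * q (θhat φ) + 2 * q (θhat ψ)) at h3
    change 0 ≤ 1 ^ 2 * q (θhat φ) + _ + (-1) ^ 2 * q (θhat ψ) at h4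
    set Q := q (θhat φ) - 2 * (θhat φ ⬝ᵥ S.mulVec (θhat ψ)) + q (θhat ψ) with hQ
    have hQ0 : 0 ≤ Q := by linarith
    set d := q (θhat ψ) - q (θhat φ) with hd
    have h5 : d ^ 2 ≤ Q * (4 * M) := h3.trans (by gcongr; linarith)
    have h6 : (φ + ψ) / 4 * Q ≤ (φ - ψ) / 2 * d := by
      rw [hd]; linarith
    have h7 : (φ - ψ) * d ≤ |ψ - φ| * |d| := by
      rw [abs_sub_comm, ← abs_mul]; exact le_abs_self _
    have h8 : 2 * a * Q ≤ (φ + ψ) * Q := by gcongr; linarith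
    have h9 : a * Q ≤ |ψ - φ| * |d| := by linarith
    have h10 : |d| * (a * |d|) ≤ |d| * (4 * M * |ψ - φ|) := by
      have : |d| * |d| = d ^ 2 := by rw [← sq, sq_abs]
      calc |d| * (a * |d|) = a * d ^ 2 := by rw [← this]; ring
        _ ≤ a * (Q * (4 * M)) := by gcongr
        _ = (a * Q) * (4 * M) := by ring
        _ ≤ (|ψ - φ| * |d|) * (4 * M) := by gcongr
        _ = _ := by ring
    have h11 : a * |d| ≤ 4 * M * |ψ - φ| := by
      rcases (abs_nonneg d).eq_or_lt with h | h
      · rw [← h]; simp; positivity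
      · exact le_of_mul_le_mul_left h10 h
    rw [← mul_sub, abs_mul, abs_of_pos (by norm_num : (0:ℝ) < 1 / 2), div_mul_eq_mul_div (2 * M) a,
      le_div_iff₀ ha]
    linarith
  constructor
  · intro φ hφ
    rw [hasDerivAt_iff_isLittleO]
    have hO : (fun ψ => α ψ - α φ - (ψ - φ) • (1 / 2 * q (θhat φ))) =O[nhds φ]
        fun ψ => (ψ - φ) ^ 2 := by
      apply Asymptotics.IsBigO.of_bound (2 * M / (φ / 2))
      filter_upwards [lt_mem_nhds (by linarith : φ / 2 < φ)] with ψ hψ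
      have hψ0 : 0 < ψ := by linarith
      have k := key (φ / 2) (by linarith) φ ψ (by linarith) hψ.le
      have u1 : _ ≤ -(μ ⬝ᵥ θhat φ) + ψ / 2 * q (θhat φ) := (hθhat ψ hψ0).2 _ (hθhat φ hφ).1
      have u2 : _ ≤ -(μ ⬝ᵥ θhat ψ) + φ / 2 * q (θhat ψ) := (hθhat φ hφ).2 _ (hθhat ψ hψ0).1
      change -(μ ⬝ᵥ θhat ψ) + ψ / 2 * q (θhat ψ) ≤ _ at u1
      change -(μ ⬝ᵥ θhat φ) + φ / 2 * q (θhat φ) ≤ _ at u2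
      rw [hmin φ hφ, hmin ψ hψ0, Real.norm_eq_abs, Real.norm_eq_abs, abs_pow, smul_eq_mul]
      calc _ ≤ |(ψ - φ) * (1 / 2 * q (θhat ψ) - 1 / 2 * q (θhat φ))| := by
            rw [abs_of_nonpos (by linarith)]
            rw [← abs_neg]
            refine le_trans ?_ (le_abs_self _)
            linarith
        _ ≤ |ψ - φ| * (2 * M / (φ / 2) * |ψ - φ|) := by rw [abs_mul]; gcongr
        _ = _ := by ring
    refine hO.trans_isLittleO ?_
    simpa [sq_abs] using Asymptotics.isLittleO_pow_sub_sub φ one_lt_two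
  · intro a b ha
    refine ⟨(2 * M / a).toNNReal, LipschitzOnWith.of_dist_le_mul ?_⟩
    intro x hx y hy
    rw [Real.dist_eq, Real.dist_eq, Real.coe_toNNReal _ (by positivity)]
    exact key a ha y x hy.1 hx.1
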